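/- arXiv:2302.03539 — 4 statements merged into one kernel-verified Lean document; each statement's English description precedes it below -/
import Mathlib

section
/- Let ν₁ be a (ψ₁, σ)-conformal Borel probability measure on F and ν₂ a (ψ₂, σ)-conformal Borel probability measure on F. If ν₂ is absolutely continuous with respect to ν₁, then ψ₁(w) = ψ₂(w) for every w in the essential subgroup E_{ν₁}. In particular, if E_{ν₁} = V, then ν₂ ≪ ν₁ implies ψ₁ = ψ₂. -/
open MeasureTheory

/-- A Borel probability measure `ν` is `(ψ, σ)`-conformal for the cocycle `σ : G → F → V`
and linear form `ψ : V → ℝ` if for every `g`, the pushforward `g_*ν` is equivalent to `ν`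
with Radon–Nikodym derivative `ξ ↦ exp (ψ (σ g ξ))`. -/
def IsConformal {G F V : Type*} [Group G] [MulAction G F] [MeasurableSpace F]
    [NormedAddCommGroup V] [NormedSpace ℝ V]
    (σ : G → F → V) (ψ : V →ₗ[ℝ] ℝ) (ν : Measure F) : Prop :=
  ∀ g : G, Measure.map (fun ξ => g • ξ) ν =
    ν.withDensity (fun ξ => ENNReal.ofReal (Real.exp (ψ (σ g ξ))))

/-- The essential subgroup of a measure `ν` with respect to a cocycle `σ`. -/
def essSubgroup {G F V : Type*} [Group G] [MulAction G F] [MeasurableSpace F]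
    [NormedAddCommGroup V] (σ : G → F → V) (ν : Measure F) : Set V :=
  {u | ∀ B : Set F, MeasurableSet B → 0 < ν B → ∀ ε : ℝ, 0 < ε →
    ∃ g : G, 0 < ν (B ∩ ((fun ξ => g • ξ) '' B) ∩ {ξ | ‖σ g ξ - u‖ < ε})}

/-- The density `f = dν₂/dν₁` of two conformal measures satisfies
`f(ξ) exp(ψ₂(σ(g, ξ))) = f(g⁻¹ξ) exp(ψ₁(σ(g, ξ)))` for almost every `ξ`. -/
lemma IsConformal.rnDeriv_mul_ae_eq {G F V : Type*} [Group G] [MeasurableSpace F] [MulAction G F]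
    [NormedAddCommGroup V] [NormedSpace ℝ V] [FiniteDimensional ℝ V]
    [MeasurableSpace V] [BorelSpace V]
    (hact : ∀ g : G, Measurable fun ξ : F => g • ξ)
    {σ : G → F → V} (hσmeas : ∀ g : G, Measurable (σ g))
    {ψ₁ ψ₂ : V →ₗ[ℝ] ℝ} {ν₁ ν₂ : Measure F} [IsFiniteMeasure ν₁] [IsFiniteMeasure ν₂]
    (h₁ : IsConformal σ ψ₁ ν₁) (h₂ : IsConformal σ ψ₂ ν₂) (habs : ν₂ ≪ ν₁) (g : G) :
    ∀ᵐ ξ ∂ν₁, ν₂.rnDeriv ν₁ ξ * ENNReal.ofReal (Real.exp (ψ₂ (σ g ξ))) =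
      ENNReal.ofReal (Real.exp (ψ₁ (σ g ξ))) * ν₂.rnDeriv ν₁ (g⁻¹ • ξ) := by
  have hexp : ∀ ψ : V →ₗ[ℝ] ℝ,
      Measurable fun ξ => ENNReal.ofReal (Real.exp (ψ (σ g ξ))) := fun ψ =>
    ((ψ.continuous_of_finiteDimensional.measurable.comp (hσmeas g)).exp).ennreal_ofReal
  have hf : Measurable (ν₂.rnDeriv ν₁) := Measure.measurable_rnDeriv ν₂ ν₁
  have hfg : Measurable fun ξ => ν₂.rnDeriv ν₁ (g⁻¹ • ξ) := hf.comp (hact g⁻¹)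
  have hf₂ : ν₁.withDensity (ν₂.rnDeriv ν₁) = ν₂ := Measure.withDensity_rnDeriv_eq ν₂ ν₁ habs
  have hleft : ν₁.withDensity (fun ξ => ν₂.rnDeriv ν₁ ξ *
      ENNReal.ofReal (Real.exp (ψ₂ (σ g ξ)))) = ν₂.map (fun ξ => g • ξ) := by
    rw [h₂ g]
    conv_rhs => rw [← hf₂]
    exact withDensity_mul ν₁ hf (hexp ψ₂)
  have hright : ν₁.withDensity (fun ξ => ENNReal.ofReal (Real.exp (ψ₁ (σ g ξ))) *
      ν₂.rnDeriv ν₁ (g⁻¹ • ξ)) = ν₂.map (fun ξ => g • ξ) := by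
    refine (withDensity_mul ν₁ (hexp ψ₁) hfg).trans ?_
    rw [← h₁ g]
    ext s hs
    rw [withDensity_apply _ hs, setLIntegral_map hs hfg (hact g), Measure.map_apply (hact g) hs]
    conv_rhs => rw [← hf₂]
    rw [withDensity_apply _ (hact g hs)]
    simp
  refine (withDensity_eq_iff ((hf.mul (hexp ψ₂)).aemeasurable)
    (((hexp ψ₁).mul hfg).aemeasurable) ?_).1 (hleft.trans hright.symm)
  rw [← setLIntegral_univ, ← withDensity_apply _ MeasurableSet.univ]
  exact hleft ▸ measure_ne_top _ _

/-- A nonzero absolutely continuous measure has a density whose logarithm, up to an error `δ`, is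
constant on a set of positive measure. -/
lemma exists_measurableSet_abs_log_rnDeriv_sub_lt {F : Type*} [MeasurableSpace F]
    {μ ν : Measure F} [SigmaFinite μ] [SigmaFinite ν] (hν : ν ≠ 0) (habs : ν ≪ μ)
    {δ : ℝ} (hδ : 0 < δ) :
    ∃ B, MeasurableSet B ∧ 0 < μ B ∧ (∀ ξ ∈ B, 0 < (ν.rnDeriv μ ξ).toReal) ∧
      ∀ ξ ∈ B, ∀ η ∈ B,
        |Real.log (ν.rnDeriv μ ξ).toReal - Real.log (ν.rnDeriv μ η).toReal| < δ := by
  set f : F → ℝ := fun ξ => (ν.rnDeriv μ ξ).toReal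
  have hf : Measurable f := (Measure.measurable_rnDeriv ν μ).ennreal_toReal
  let B : ℤ → Set F := fun n => {ξ | 0 < f ξ} ∩ {ξ | ⌊Real.log (f ξ) / δ⌋ = n}
  have hB : ∀ n, MeasurableSet (B n) := fun n =>
    (measurableSet_lt measurable_const hf).inter
      ((Int.measurable_floor.comp (hf.log.div_const δ)) (measurableSet_singleton n))
  obtain ⟨n, hn⟩ : ∃ n, 0 < μ (B n) := by
    by_contra! h
    have hpos : μ {ξ | 0 < f ξ} = 0 :=
      measure_mono_null (t := ⋃ n, B n) (fun ξ hξ => Set.mem_iUnion.2 ⟨_, hξ, rfl⟩)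
        (measure_iUnion_null fun n => nonpos_iff_eq_zero.1 (h n))
    have hzero : ν.rnDeriv μ =ᵐ[μ] 0 := by
      filter_upwards [measure_eq_zero_iff_ae_notMem.1 hpos, Measure.rnDeriv_ne_top ν μ]
        with ξ hξ htop
      by_contra hne
      exact hξ (ENNReal.toReal_pos hne htop)
    apply hν
    rw [← Measure.withDensity_rnDeriv_eq ν μ habs, withDensity_congr_ae hzero, withDensity_zero]
  refine ⟨B n, hB n, hn, fun ξ hξ => hξ.1, fun ξ hξ η hη => ?_⟩
  have h := Int.abs_sub_lt_one_of_floor_eq_floor (hξ.2.trans hη.2.symm)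
  rwa [← sub_div, abs_div, abs_of_pos hδ, div_lt_one hδ] at h

/-- If `ν₁` is `(ψ₁, σ)`-conformal, `ν₂` is `(ψ₂, σ)`-conformal and `ν₂ ≪ ν₁`, then
`ψ₁ = ψ₂` on the essential subgroup of `ν₁`; in particular if the essential subgroup
is all of `V` then `ψ₁ = ψ₂`. -/
theorem conformal_linear_forms_eq_on_essSubgroup
    {G F V : Type*} [Group G] [Countable G] [MeasurableSpace F] [StandardBorelSpace F]
    [MulAction G F]
    [NormedAddCommGroup V] [NormedSpace ℝ V] [FiniteDimensional ℝ V]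
    [MeasurableSpace V] [BorelSpace V]
    (hact : ∀ g : G, Measurable fun ξ : F => g • ξ)
    (σ : G → F → V) (hσmeas : ∀ g : G, Measurable (σ g))
    (hcoc : ∀ g h : G, ∀ ξ : F, σ (g * h) ξ = σ g ξ + σ h (g⁻¹ • ξ))
    (ψ₁ ψ₂ : V →ₗ[ℝ] ℝ) (ν₁ ν₂ : Measure F)
    [IsProbabilityMeasure ν₁] [IsProbabilityMeasure ν₂]
    (h₁ : IsConformal σ ψ₁ ν₁) (h₂ : IsConformal σ ψ₂ ν₂)
    (habs : ν₂ ≪ ν₁) :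
    (∀ w ∈ essSubgroup σ ν₁, ψ₁ w = ψ₂ w) ∧
      (essSubgroup σ ν₁ = Set.univ → ψ₁ = ψ₂) := by
  have key : ∀ w ∈ essSubgroup σ ν₁, ψ₁ w = ψ₂ w := by
    intro w hw
    have hcont : Continuous (ψ₁ - ψ₂) := (ψ₁ - ψ₂).continuous_of_finiteDimensional
    refine sub_eq_zero.1 (abs_nonpos_iff.1 (le_of_forall_pos_le_add fun δ hδ => ?_))
    obtain ⟨ε, hε, hclose⟩ := Metric.continuousAt_iff.1 hcont.continuousAt (δ / 2) (half_pos hδ)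
    obtain ⟨B, hB, hBpos, hfpos, hlog⟩ := exists_measurableSet_abs_log_rnDeriv_sub_lt
      (IsProbabilityMeasure.ne_zero ν₂) habs (half_pos hδ)
    obtain ⟨g, hg⟩ := hw B hB hBpos ε hε
    obtain ⟨ξ, ⟨⟨hξ, η, hη, rfl⟩, hσ⟩, hrel⟩ := Filter.Frequently.exists
      ((frequently_ae_mem_iff.2 hg.ne').and_eventually
        (h₁.rnDeriv_mul_ae_eq hact hσmeas h₂ habs g))
    have hrel' := congrArg (fun x => Real.log x.toReal) hrel
    simp only [inv_smul_smul, ENNReal.toReal_mul, ENNReal.toReal_ofReal (Real.exp_pos _).le]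
      at hrel'
    rw [Real.log_mul (hfpos _ hξ).ne' (Real.exp_pos _).ne',
      Real.log_mul (Real.exp_pos _).ne' (hfpos _ hη).ne', Real.log_exp, Real.log_exp] at hrel'
    have hdist := hclose (x := σ g (g • η)) (by rwa [dist_eq_norm])
    have hdiff := hlog _ hξ _ hη
    rw [Real.dist_eq, LinearMap.sub_apply, LinearMap.sub_apply, abs_lt] at hdist
    rw [abs_lt] at hdiff
    rw [zero_add, abs_le]
    constructor <;> linarith [hdist.1, hdist.2, hdiff.1, hdiff.2]
  exact ⟨key, fun h => LinearMap.ext fun w => key w (h ▸ Set.mem_univ w)⟩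
end

section
/- Suppose Γ acts measurably on standard Borel spaces F₁ and F₂, with cocycles σᵢ : Γ × Fᵢ → Vᵢ (i = 1, 2) into finite-dimensional real normed vector spaces, and acts diagonally on F₁ × F₂, which carries the product cocycle σ(g, (ξ, η)) := (σ₁(g, ξ), σ₂(g, η)) ∈ V₁ × V₂. Let Λ ⊆ F₁ be a Γ-invariant Borel set and f : Λ → F₂ an injective Γ-equivariant Borel map. Let ν₁ be a (ψ₁, σ₁)-conformal Borel probability measure concentrated on Λ, and ν₂ a (ψ₂, σ₂)-conformal Borel probability measure concentrated on f(Λ), where ψᵢ : Vᵢ → ℝ are linear forms. Let μ₁ be the pushforward of ν₁ under ξ ↦ (ξ, f(ξ)) and μ₂ the pushforward of ν₂ under η ↦ (f⁻¹(η), η). If the essential subgroup E_{μ₁} of μ₁ (with respect to the product cocycle σ) is not contained in {(u₁, u₂) ∈ V₁ × V₂ : ψ₁(u₁) = ψ₂(u₂)}, then μ₂ is not absolutely continuous with respect to μ₁, and consequently ν₂ is not absolutely continuous with respect to the pushforward f_*ν₁. -/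
open MeasureTheory

/-- Pushing forward a measure with density of the form `d ∘ h` along `h`. -/
theorem map_withDensity_comp {X Y : Type*} [MeasurableSpace X] [MeasurableSpace Y]
    {ν : Measure X} {h : X → Y} (hh : Measurable h) {d : Y → ENNReal} (hd : Measurable d) :
    (ν.withDensity (fun x => d (h x))).map h = (ν.map h).withDensity d := by
  ext s hs
  rw [Measure.map_apply hh hs, withDensity_apply _ (hh hs), withDensity_apply _ hs,
    setLIntegral_map hs hd hh]

/-- The pushforward of a conformal measure under an almost everywhere equivariant map is
conformal. -/
theorem IsConformal.map {G X Y V W : Type*} [Group G] [MulAction G X] [MulAction G Y]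
    [MeasurableSpace X] [MeasurableSpace Y]
    [NormedAddCommGroup V] [NormedSpace ℝ V] [NormedAddCommGroup W] [NormedSpace ℝ W]
    {σ : G → X → V} {ψ : V →ₗ[ℝ] ℝ} {τ : G → Y → W} {φ : W →ₗ[ℝ] ℝ} {ν : Measure X}
    (hν : IsConformal σ ψ ν) (hX : ∀ g : G, Measurable fun x : X => g • x)
    (hY : ∀ g : G, Measurable fun y : Y => g • y) (hτ : ∀ g, Measurable fun y => φ (τ g y))
    {h : X → Y} (hh : Measurable h) (hequiv : ∀ g : G, ∀ᵐ x ∂ν, h (g • x) = g • h x)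
    (hcoc : ∀ g x, φ (τ g (h x)) = ψ (σ g x)) : IsConformal τ φ (ν.map h) := by
  intro g
  rw [Measure.map_map (hY g) hh, ← map_withDensity_comp hh (hτ g).exp.ennreal_ofReal]
  simp only [hcoc]
  rw [← hν g, Measure.map_map hh (hX g)]
  refine Measure.map_congr ?_
  filter_upwards [hequiv g] with x hx using hx.symm

/-- The density of one conformal measure with respect to another transforms by the quotient of
the two conformal factors. -/
theorem IsConformal.rnDeriv_smul {G X V : Type*} [Group G] [MulAction G X] [MeasurableSpace X]
    [NormedAddCommGroup V] [NormedSpace ℝ V] {σ : G → X → V} {ψ φ : V →ₗ[ℝ] ℝ}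
    {μ ν : Measure X} [IsFiniteMeasure μ] [IsFiniteMeasure ν]
    (hμ : IsConformal σ ψ μ) (hν : IsConformal σ φ ν) (hac : ν ≪ μ)
    (hX : ∀ g : G, Measurable fun x : X => g • x)
    (hψ : ∀ g, Measurable fun x => ψ (σ g x)) (hφ : ∀ g, Measurable fun x => φ (σ g x)) (g : G) :
    ∀ᵐ x ∂μ, ENNReal.ofReal (Real.exp (ψ (σ g x))) * ν.rnDeriv μ (g⁻¹ • x) =
      ν.rnDeriv μ x * ENNReal.ofReal (Real.exp (φ (σ g x))) := by
  have hr : Measurable (ν.rnDeriv μ) := Measure.measurable_rnDeriv ν μ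
  have hrg : Measurable fun x => ν.rnDeriv μ (g⁻¹ • x) := hr.comp (hX g⁻¹)
  have ha : Measurable fun x => ENNReal.ofReal (Real.exp (ψ (σ g x))) :=
    (hψ g).exp.ennreal_ofReal
  have hb : Measurable fun x => ENNReal.ofReal (Real.exp (φ (σ g x))) :=
    (hφ g).exp.ennreal_ofReal
  have key := map_withDensity_comp (ν := μ) (hX g) hrg
  simp only [inv_smul_smul] at key
  rw [Measure.withDensity_rnDeriv_eq ν μ hac, hμ g, hν g,
    ← withDensity_mul _ ha hrg] at key
  nth_rewrite 1 [← Measure.withDensity_rnDeriv_eq ν μ hac] at key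
  rw [← withDensity_mul _ hr hb] at key
  exact ((withDensity_eq_iff_of_sigmaFinite (hr.mul hb).aemeasurable
    (ha.mul hrg).aemeasurable).1 key).symm

/-- If a nonzero `(φ, σ)`-conformal measure is absolutely continuous with respect to a
`(ψ, σ)`-conformal measure, then `ψ = φ` on the essential subgroup of the latter. -/
theorem IsConformal.essSubgroup_subset {G X V : Type*} [Group G] [MulAction G X]
    [MeasurableSpace X] [NormedAddCommGroup V] [NormedSpace ℝ V] [FiniteDimensional ℝ V]
    {σ : G → X → V} {ψ φ : V →ₗ[ℝ] ℝ}
    {μ ν : Measure X} [IsFiniteMeasure μ] [IsFiniteMeasure ν]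
    (hμ : IsConformal σ ψ μ) (hν : IsConformal σ φ ν) (hac : ν ≪ μ) (hν0 : ν ≠ 0)
    (hX : ∀ g : G, Measurable fun x : X => g • x)
    (hψ : ∀ g, Measurable fun x => ψ (σ g x)) (hφ : ∀ g, Measurable fun x => φ (σ g x)) :
    essSubgroup σ μ ⊆ {u | ψ u = φ u} := by
  intro u hu
  by_contra hne
  have hδ : 0 < |(ψ - φ) u| := abs_pos.2 (by simpa [sub_eq_zero] using hne)
  set δ := |(ψ - φ) u|
  have hr : Measurable (ν.rnDeriv μ) := Measure.measurable_rnDeriv ν μ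
  obtain ⟨ε, hε, hball⟩ := Metric.continuous_iff.1
    (LinearMap.continuous_of_finiteDimensional (ψ - φ)) u (δ / 2) (by positivity)
  let L : X → ℝ := fun x => Real.log (ν.rnDeriv μ x).toReal
  have hL : Measurable L := by fun_prop
  let B : ℤ → Set X := fun k => {x | ν.rnDeriv μ x ≠ 0} ∩ {x | ν.rnDeriv μ x ≠ ⊤} ∩
    {x | ⌊L x / (δ / 2)⌋ = k}
  have hB (k : ℤ) : MeasurableSet (B k) :=
    ((hr (measurableSet_singleton 0).compl).inter (hr (measurableSet_singleton ⊤).compl)).inter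
      ((hL.div_const _).floor (measurableSet_singleton k))
  have hBnull (k : ℤ) : μ (B k) = 0 := by
    by_contra hk
    obtain ⟨g, hg⟩ := hu (B k) (hB k) (pos_iff_ne_zero.2 hk) ε hε
    refine hg.ne' (measure_mono_null ?_ (hμ.rnDeriv_smul hν hac hX hψ hφ g))
    rintro x ⟨⟨⟨⟨hx0, hxt⟩, hxk⟩, y, ⟨⟨hy0, hyt⟩, hyk⟩, rfl⟩, hxu⟩ heq
    simp only [Set.mem_ofPred_eq, inv_smul_smul] at hx0 hxt hxk hy0 hyt hyk hxu heq
    have hlog := congrArg (fun t => Real.log t.toReal) heq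
    simp only [ENNReal.toReal_mul, ENNReal.toReal_ofReal (Real.exp_nonneg _)] at hlog
    rw [Real.log_mul (Real.exp_ne_zero _) (ENNReal.toReal_ne_zero.2 ⟨hy0, hyt⟩),
      Real.log_mul (ENNReal.toReal_ne_zero.2 ⟨hx0, hxt⟩) (Real.exp_ne_zero _),
      Real.log_exp, Real.log_exp] at hlog
    change _ + L y = L (g • y) + _ at hlog
    have hclose := Int.abs_sub_lt_one_of_floor_eq_floor (hxk.trans hyk.symm)
    rw [← sub_div, abs_div, abs_of_pos (half_pos hδ), div_lt_one (half_pos hδ)] at hclose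
    have hdist := hball (σ g (g • y)) (by rwa [dist_eq_norm])
    rw [Real.dist_eq] at hdist
    have hsub : (ψ - φ) (σ g (g • y)) = L (g • y) - L y := by
      rw [LinearMap.sub_apply]; linarith
    rw [hsub] at hdist
    have htri := abs_sub_abs_le_abs_sub ((ψ - φ) u) (L (g • y) - L y)
    rw [abs_sub_comm ((ψ - φ) u)] at htri
    linarith
  have hzero : ν.rnDeriv μ =ᵐ[μ] 0 := by
    filter_upwards [Measure.rnDeriv_lt_top ν μ,
      ae_all_iff.2 fun k => measure_eq_zero_iff_ae_notMem.1 (hBnull k)] with x hxt hx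
    by_contra hx0
    exact hx _ ⟨⟨hx0, hxt.ne⟩, rfl⟩
  exact hν0 (by rw [← Measure.withDensity_rnDeriv_eq ν μ hac, withDensity_congr_ae hzero,
    withDensity_zero])

/-- Key proposition: if the essential subgroup of the graph-conformal measure
`μ₁ = (id × f)_* ν₁` (w.r.t. the product cocycle) is not contained in
`{(u₁, u₂) : ψ₁ u₁ = ψ₂ u₂}`, then `μ₂ = (f⁻¹ × id)_* ν₂` is not absolutely continuous
with respect to `μ₁`, and hence `ν₂` is not absolutely continuous with respect to `f_* ν₁`. -/
theorem not_absolutelyContinuous_of_essSubgroup_not_subset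
    {G F₁ F₂ V₁ V₂ : Type*} [Group G] [Countable G]
    [MeasurableSpace F₁] [StandardBorelSpace F₁]
    [MeasurableSpace F₂] [StandardBorelSpace F₂]
    [MulAction G F₁] [MulAction G F₂]
    [NormedAddCommGroup V₁] [NormedSpace ℝ V₁] [FiniteDimensional ℝ V₁]
    [MeasurableSpace V₁] [BorelSpace V₁]
    [NormedAddCommGroup V₂] [NormedSpace ℝ V₂] [FiniteDimensional ℝ V₂]
    [MeasurableSpace V₂] [BorelSpace V₂]
    (hact₁ : ∀ g : G, Measurable fun ξ : F₁ => g • ξ)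
    (hact₂ : ∀ g : G, Measurable fun η : F₂ => g • η)
    (σ₁ : G → F₁ → V₁) (σ₂ : G → F₂ → V₂)
    (hmeas₁ : ∀ g : G, Measurable (σ₁ g)) (hmeas₂ : ∀ g : G, Measurable (σ₂ g))
    (hcoc₁ : ∀ g h : G, ∀ ξ : F₁, σ₁ (g * h) ξ = σ₁ g ξ + σ₁ h (g⁻¹ • ξ))
    (hcoc₂ : ∀ g h : G, ∀ η : F₂, σ₂ (g * h) η = σ₂ g η + σ₂ h (g⁻¹ • η))
    (Λ : Set F₁) (hΛmeas : MeasurableSet Λ)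
    (hΛinv : ∀ g : G, ∀ ξ ∈ Λ, g • ξ ∈ Λ)
    (f : F₁ → F₂) (hf : Measurable f) (hfinj : Set.InjOn f Λ)
    (hfequiv : ∀ g : G, ∀ ξ ∈ Λ, f (g • ξ) = g • f ξ)
    (finv : F₂ → F₁) (hfinvmeas : Measurable finv)
    (hfinvf : ∀ ξ ∈ Λ, finv (f ξ) = ξ)
    (ψ₁ : V₁ →ₗ[ℝ] ℝ) (ψ₂ : V₂ →ₗ[ℝ] ℝ)
    (ν₁ : Measure F₁) (ν₂ : Measure F₂)
    [IsProbabilityMeasure ν₁] [IsProbabilityMeasure ν₂]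
    (h₁ : IsConformal σ₁ ψ₁ ν₁) (h₂ : IsConformal σ₂ ψ₂ ν₂)
    (hν₁conc : ν₁ Λᶜ = 0) (hν₂conc : ν₂ (f '' Λ)ᶜ = 0)
    (hess : ¬ essSubgroup (fun g p => (σ₁ g p.1, σ₂ g p.2))
        (Measure.map (fun ξ => (ξ, f ξ)) ν₁) ⊆ {p : V₁ × V₂ | ψ₁ p.1 = ψ₂ p.2}) :
    ¬ (Measure.map (fun η => (finv η, η)) ν₂) ≪ (Measure.map (fun ξ => (ξ, f ξ)) ν₁) ∧
      ¬ ν₂ ≪ Measure.map f ν₁ := by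
  have hX (g : G) : Measurable fun p : F₁ × F₂ => g • p :=
    ((hact₁ g).comp measurable_fst).prodMk ((hact₂ g).comp measurable_snd)
  have hψ (g : G) : Measurable fun p : F₁ × F₂ =>
      (ψ₁ ∘ₗ LinearMap.fst ℝ V₁ V₂) (σ₁ g p.1, σ₂ g p.2) :=
    ψ₁.continuous_of_finiteDimensional.measurable.comp ((hmeas₁ g).comp measurable_fst)
  have hφ (g : G) : Measurable fun p : F₁ × F₂ =>
      (ψ₂ ∘ₗ LinearMap.snd ℝ V₁ V₂) (σ₁ g p.1, σ₂ g p.2) :=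
    ψ₂.continuous_of_finiteDimensional.measurable.comp ((hmeas₂ g).comp measurable_snd)
  have hgraph₁ : Measurable fun ξ => (ξ, f ξ) := measurable_id.prodMk hf
  have hgraph₂ : Measurable fun η => (finv η, η) := hfinvmeas.prodMk measurable_id
  have hΛae : ∀ᵐ ξ ∂ν₁, ξ ∈ Λ := hν₁conc
  have hfΛae : ∀ᵐ η ∂ν₂, η ∈ f '' Λ := hν₂conc
  have hμ₁ : IsConformal (fun g (p : F₁ × F₂) => (σ₁ g p.1, σ₂ g p.2))
      (ψ₁ ∘ₗ LinearMap.fst ℝ V₁ V₂) (Measure.map (fun ξ => (ξ, f ξ)) ν₁) := by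
    refine h₁.map hact₁ hX hψ hgraph₁ (fun g => ?_) fun _ _ => rfl
    filter_upwards [hΛae] with ξ hξ
    simp [hfequiv g ξ hξ]
  have hμ₂ : IsConformal (fun g (p : F₁ × F₂) => (σ₁ g p.1, σ₂ g p.2))
      (ψ₂ ∘ₗ LinearMap.snd ℝ V₁ V₂) (Measure.map (fun η => (finv η, η)) ν₂) := by
    refine h₂.map hact₂ hX hφ hgraph₂ (fun g => ?_) fun _ _ => rfl
    filter_upwards [hfΛae] with η hη
    obtain ⟨ξ, hξ, rfl⟩ := hη
    simp [← hfequiv g ξ hξ, hfinvf _ hξ, hfinvf _ (hΛinv g ξ hξ)]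
  have := Measure.isProbabilityMeasure_map (μ := ν₁) hgraph₁.aemeasurable
  have := Measure.isProbabilityMeasure_map (μ := ν₂) hgraph₂.aemeasurable
  have hnot : ¬ (Measure.map (fun η => (finv η, η)) ν₂) ≪
      (Measure.map (fun ξ => (ξ, f ξ)) ν₁) := fun hac =>
    hess (hμ₁.essSubgroup_subset hμ₂ hac (IsProbabilityMeasure.ne_zero _) hX hψ hφ)
  refine ⟨hnot, fun hac => hnot ?_⟩
  have hmap := hac.map hgraph₂
  rw [Measure.map_map hgraph₂ hf] at hmap
  rwa [Measure.map_congr (g := fun ξ => (ξ, f ξ))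
    (by filter_upwards [hΛae] with ξ hξ; simp [hfinvf ξ hξ])] at hmap
end

section
/- Let ν be a Γ-quasi-invariant Borel probability measure on F (i.e., g_*ν is equivalent to ν for every g ∈ Γ). Then the essential subgroup E_ν := {u ∈ V : for every Borel B ⊆ F with ν(B) > 0 and every ε > 0 there exists g ∈ Γ with ν(B ∩ gB ∩ {ξ : ‖σ(g, ξ) − u‖ < ε}) > 0} is a closed additive subgroup of V. -/
open MeasureTheory

/-- If the push-forward of `ν` under translation by `g` is absolutely continuous with respect to
`ν`, then translation by `g` maps sets of positive measure to sets of positive measure. -/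
theorem measure_smul_image_pos {G F : Type*} [Group G] [MulAction G F] [MeasurableSpace F]
    {ν : Measure F} {g : G} (hact : Measurable fun ξ : F => g • ξ)
    (hq : Measure.map (fun ξ => g • ξ) ν ≪ ν) {S : Set F} (hS : 0 < ν S) :
    0 < ν ((fun ξ => g • ξ) '' S) := by
  refine pos_iff_ne_zero.2 fun h0 => hS.ne' (le_antisymm ?_ zero_le)
  calc ν S ≤ ν ((fun ξ => g • ξ) ⁻¹' ((fun ξ => g • ξ) '' S)) :=
        measure_mono (Set.subset_preimage_image _ _)
    _ ≤ Measure.map (fun ξ => g • ξ) ν ((fun ξ => g • ξ) '' S) :=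
        Measure.le_map_apply hact.aemeasurable _
    _ = 0 := hq h0

/-- The essential subgroup is closed, for any map `σ` and any measure. -/
theorem isClosed_essSubgroup {G F V : Type*} [Group G] [MulAction G F] [MeasurableSpace F]
    [NormedAddCommGroup V] (σ : G → F → V) (ν : Measure F) : IsClosed (essSubgroup σ ν) := by
  refine isClosed_of_closure_subset fun u hu B hB hpos ε hε => ?_
  obtain ⟨v, hv, huv⟩ := Metric.mem_closure_iff.1 hu (ε / 2) (half_pos hε)
  obtain ⟨g, hg⟩ := hv B hB hpos (ε / 2) (half_pos hε)
  refine ⟨g, hg.trans_le (measure_mono (Set.inter_subset_inter_right _ fun ξ hξ => ?_))⟩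
  rw [dist_comm, dist_eq_norm] at huv
  have htri := norm_sub_le_norm_sub_add_norm_sub (σ g ξ) v u
  simp only [Set.mem_ofPred_eq] at hξ ⊢
  linarith

/-- For a `Γ`-quasi-invariant Borel probability measure `ν`, the essential subgroup
`E_ν` is a closed additive subgroup of `V`. -/
theorem essSubgroup_isClosed_addSubgroup
    {G F V : Type*} [Group G] [Countable G] [MeasurableSpace F] [StandardBorelSpace F]
    [MulAction G F]
    [NormedAddCommGroup V] [NormedSpace ℝ V] [FiniteDimensional ℝ V]
    [MeasurableSpace V] [BorelSpace V]
    (hact : ∀ g : G, Measurable fun ξ : F => g • ξ)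
    (σ : G → F → V) (hσmeas : ∀ g : G, Measurable (σ g))
    (hcoc : ∀ g h : G, ∀ ξ : F, σ (g * h) ξ = σ g ξ + σ h (g⁻¹ • ξ))
    (ν : Measure F) [IsProbabilityMeasure ν]
    (hq : ∀ g : G, Measure.map (fun ξ => g • ξ) ν ≪ ν ∧
      ν ≪ Measure.map (fun ξ => g • ξ) ν) :
    ∃ H : AddSubgroup V, (H : Set V) = essSubgroup σ ν ∧ IsClosed (essSubgroup σ ν) := by
  have hone (ξ : F) : σ 1 ξ = 0 := by simpa using hcoc 1 1 ξ
  refine ⟨{ carrier := essSubgroup σ ν, zero_mem' := ?_, add_mem' := ?_, neg_mem' := ?_ }, rfl,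
    isClosed_essSubgroup σ ν⟩
  · rintro u v hu hv B hB hpos ε hε
    obtain ⟨g, hg⟩ := hu B hB hpos (ε / 2) (half_pos hε)
    set A := B ∩ ((fun ξ => g • ξ) '' B) ∩ {ξ | ‖σ g ξ - u‖ < ε / 2} with hA
    have himage : (fun ξ : F => g • ξ) '' B = (fun ξ => g⁻¹ • ξ) ⁻¹' B :=
      (Set.preimage_smul_inv g B).symm
    have hAmeas : MeasurableSet A := by
      rw [hA, himage]
      exact (hB.inter (hact g⁻¹ hB)).inter
        (measurableSet_lt ((hσmeas g).sub_const u).norm measurable_const)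
    have hCpos : 0 < ν ((fun ξ => g • ξ) ⁻¹' A) := by
      have := measure_smul_image_pos (hact g⁻¹) (hq g⁻¹).1 hg
      rwa [show (fun ξ : F => g⁻¹ • ξ) '' A = (fun ξ => g • ξ) ⁻¹' A from
        (Set.preimage_smul g A).symm] at this
    obtain ⟨h, hh⟩ := hv _ (hact g hAmeas) hCpos (ε / 2) (half_pos hε)
    refine ⟨g * h, (measure_smul_image_pos (hact g) (hq g).1 hh).trans_le (measure_mono ?_)⟩
    rintro _ ⟨ξ, ⟨⟨hξ, η, hη, rfl⟩, hσξ⟩, rfl⟩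
    have hηB : η ∈ B := by
      obtain ⟨ζ, hζ, hζη⟩ := hη.1.2
      rwa [← MulAction.injective g hζη]
    refine ⟨⟨hξ.1.1, η, hηB, mul_smul g h η⟩, ?_⟩
    have hσg : ‖σ g (g • h • η) - u‖ < ε / 2 := hξ.2
    simp only [Set.mem_ofPred_eq] at hσξ ⊢
    rw [hcoc, inv_smul_smul, add_sub_add_comm]
    exact (norm_add_le _ _).trans_lt (by linarith)
  · intro B _ hpos ε hε
    exact ⟨1, by simpa [hone, hε] using hpos⟩
  · intro u hu B hB hpos ε hε
    obtain ⟨g, hg⟩ := hu B hB hpos ε hε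
    refine ⟨g⁻¹, (measure_smul_image_pos (hact g⁻¹) (hq g⁻¹).1 hg).trans_le (measure_mono ?_)⟩
    rintro _ ⟨_, ⟨⟨hξ, η, hη, rfl⟩, hσξ⟩, rfl⟩
    refine ⟨⟨by simpa using hη, _, hξ, rfl⟩, ?_⟩
    have hinv := hcoc g g⁻¹ (g • η)
    rw [mul_inv_cancel, hone] at hinv
    simp only [Set.mem_ofPred_eq] at hσξ ⊢
    rwa [eq_neg_of_add_eq_zero_right hinv.symm, ← neg_sub', norm_neg]
end

section
/- Let a < b be real numbers, let f : ℝ → ℝ be concave and continuous on the interval [a, b], and let Φ be a finite set of affine functions ℝ → ℝ such that φ(x) ≥ f(x) for every φ ∈ Φ and every x ∈ [a, b], and such that for every x ∈ [a, b] there exists φ ∈ Φ with φ(x) = f(x). Then there exist an integer n ≥ 1, points a = w₀ < w₁ < ⋯ < wₙ = b, and φ₁, …, φₙ ∈ Φ such that f coincides with φᵢ on [wᵢ₋₁, wᵢ] for each 1 ≤ i ≤ n. -/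
/-- If a concave function is dominated by an affine function on `s` and meets it at `c, d ∈ s`,
then the two coincide on `[c, d]`. -/
theorem ConcaveOn.eq_affineMap_of_mem_Icc {s : Set ℝ} {f : ℝ → ℝ} (hf : ConcaveOn ℝ s f)
    {φ : ℝ →ᵃ[ℝ] ℝ} (hdom : ∀ x ∈ s, f x ≤ φ x) {c d x : ℝ} (hc : c ∈ s) (hd : d ∈ s)
    (hφc : φ c = f c) (hφd : φ d = f d) (hx : x ∈ Set.Icc c d) : f x = φ x := by
  obtain ⟨u, v, hu, hv, huv, rfl⟩ : x ∈ segment ℝ c d :=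
    (segment_eq_Icc (hx.1.trans hx.2)).symm ▸ hx
  refine (hdom _ (hf.1 hc hd hu hv huv)).antisymm ?_
  rw [Convex.combo_affine_apply huv, hφc, hφd]
  exact hf.2 hc hd hu hv huv

/-- If at every point of `(c, b]` a continuous function meets one of finitely many affine
functions, then it also does so at `c`. -/
theorem ContinuousOn.exists_affineMap_eq_left {c b : ℝ} (hcb : c < b) {f : ℝ → ℝ}
    (hf : ContinuousOn f (Set.Icc c b)) (Ψ : Finset (ℝ →ᵃ[ℝ] ℝ))
    (h : ∀ x ∈ Set.Ioc c b, ∃ φ ∈ Ψ, φ x = f x) : ∃ φ ∈ Ψ, φ c = f c := by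
  have hclosed : IsClosed (⋃ φ ∈ Ψ, {x ∈ Set.Icc c b | φ x = f x}) :=
    Ψ.finite_toSet.isClosed_biUnion fun φ _ =>
      isClosed_Icc.isClosed_eq φ.continuous_of_finiteDimensional.continuousOn hf
  have hsub : Set.Ioc c b ⊆ ⋃ φ ∈ Ψ, {x ∈ Set.Icc c b | φ x = f x} := by
    intro x hx
    obtain ⟨φ, hφ, hφx⟩ := h x hx
    exact Set.mem_biUnion hφ ⟨Set.Ioc_subset_Icc_self hx, hφx⟩
  have hc := hclosed.closure_subset_iff.2 hsub
    (closure_Ioc hcb.ne ▸ Set.left_mem_Icc.2 hcb.le : c ∈ closure (Set.Ioc c b))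
  simp only [Set.mem_iUnion] at hc
  obtain ⟨φ, hφ, -, hφc⟩ := hc
  exact ⟨φ, hφ, hφc⟩

/-- Finite-partition step: if a concave continuous function `f` on `[a, b]` is dominated
by a finite set `Φ` of affine functions, each point of `[a, b]` being a touching point of
some member of `Φ`, then `[a, b]` can be partitioned into finitely many subintervals on
each of which `f` coincides with a member of `Φ`. -/
theorem concave_finite_affine_partition
    (a b : ℝ) (hab : a < b) (f : ℝ → ℝ)
    (hconc : ConcaveOn ℝ (Set.Icc a b) f)
    (hcont : ContinuousOn f (Set.Icc a b))
    (Φ : Finset (ℝ →ᵃ[ℝ] ℝ))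
    (hdom : ∀ φ ∈ Φ, ∀ x ∈ Set.Icc a b, f x ≤ φ x)
    (htouch : ∀ x ∈ Set.Icc a b, ∃ φ ∈ Φ, φ x = f x) :
    ∃ n : ℕ, 1 ≤ n ∧ ∃ w : ℕ → ℝ, w 0 = a ∧ w n = b ∧
      (∀ i < n, w i < w (i + 1)) ∧
      ∃ φ : ℕ → (ℝ →ᵃ[ℝ] ℝ), ∀ i < n, φ i ∈ Φ ∧
        ∀ x ∈ Set.Icc (w i) (w (i + 1)), f x = φ i x := by
  classical
  induction Φ using Finset.strongInduction generalizing a with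
  | H Φ ih =>
  obtain ⟨φ, hφ, hφa⟩ := htouch a (Set.left_mem_Icc.2 hab.le)
  have hcompact : IsCompact {x ∈ Set.Icc a b | φ x = f x} :=
    isCompact_Icc.of_isClosed_subset
      (isClosed_Icc.isClosed_eq φ.continuous_of_finiteDimensional.continuousOn hcont)
      (Set.sep_subset _ _)
  -- `c` is the last point at which `φ` touches `f`
  obtain ⟨c, ⟨hc, hφc⟩, hmax⟩ :=
    hcompact.exists_isGreatest ⟨a, Set.left_mem_Icc.2 hab.le, hφa⟩
  have heq : ∀ x ∈ Set.Icc a c, f x = φ x := fun x hx =>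
    hconc.eq_affineMap_of_mem_Icc (hdom φ hφ) (Set.left_mem_Icc.2 hab.le) hc hφa hφc hx
  rcases hc.2.eq_or_lt with rfl | hcb
  · exact ⟨1, le_rfl, fun i => if i = 0 then a else c, by simp, by simp, by simpa using hab,
      fun _ => φ, by simpa using ⟨hφ, fun x h₁ h₂ => heq x ⟨h₁, h₂⟩⟩⟩
  have hsub : Set.Icc c b ⊆ Set.Icc a b := Set.Icc_subset_Icc_left hc.1
  have htouch_Ioc : ∀ x ∈ Set.Ioc c b, ∃ ψ ∈ Φ.erase φ, ψ x = f x := by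
    intro x hx
    have hxab := hsub (Set.Ioc_subset_Icc_self hx)
    obtain ⟨ψ, hψ, hψx⟩ := htouch x hxab
    refine ⟨ψ, Finset.mem_erase.2 ⟨?_, hψ⟩, hψx⟩
    rintro rfl
    exact hx.1.not_ge (hmax ⟨hxab, hψx⟩)
  have htouch_Icc : ∀ x ∈ Set.Icc c b, ∃ ψ ∈ Φ.erase φ, ψ x = f x := by
    intro x hx
    rcases hx.1.eq_or_lt with rfl | hcx
    · exact (hcont.mono hsub).exists_affineMap_eq_left hcb _ htouch_Ioc
    · exact htouch_Ioc x ⟨hcx, hx.2⟩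
  obtain ⟨n, hn, w, hw0, hwn, hw, ψ, hψ⟩ := ih (Φ.erase φ) (Finset.erase_ssubset hφ) c hcb
    (hconc.subset hsub (convex_Icc c b)) (hcont.mono hsub)
    (fun ψ hψ x hx => hdom ψ (Finset.mem_of_mem_erase hψ) x (hsub hx)) htouch_Icc
  have hψΦ : ∀ i < n, ψ i ∈ Φ ∧ ∀ x ∈ Set.Icc (w i) (w (i + 1)), f x = ψ i x := fun i hi =>
    ⟨Finset.mem_of_mem_erase (hψ i hi).1, (hψ i hi).2⟩
  rcases hc.1.eq_or_lt with rfl | hac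
  · exact ⟨n, hn, w, hw0, hwn, hw, ψ, hψΦ⟩
  · refine ⟨n + 1, n.succ_pos, fun i => Nat.casesOn i a w, rfl, hwn, ?_,
      fun i => Nat.casesOn i φ ψ, ?_⟩
    · rintro (_ | i) hi
      · simpa [hw0] using hac
      · exact hw i (Nat.lt_of_succ_lt_succ hi)
    · rintro (_ | i) hi
      · exact ⟨hφ, fun x hx => heq x (by simpa [hw0] using hx)⟩
      · exact hψΦ i (Nat.lt_of_succ_lt_succ hi)
end
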